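/- Assume K satisfies (K1) and f satisfies (f1) and (f2). Then the set N of initial values of crossing solutions and the set P of initial values of positive solutions are open subsets of (u₀,∞). -/

import Mathlib

open Set Filter Topology MeasureTheory
open scoped ENNReal NNReal

noncomputable section

/-- `φ_p(s) = |s|^{p-2} s` (with the convention `φ_p(0)=0`). -/
def phiP (p s : ℝ) : ℝ := |s| ^ (p - 2) * s

/-- `K` is strictly positive and `C¹` on `(0,∞)` and satisfies condition (K1):
the map `r ↦ p + r·K'(r)/K(r)` is strictly positive and decreasing on `(0,∞)`. -/
def CondK1 (p : ℝ) (K : ℝ → ℝ) : Prop :=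
  (∀ r : ℝ, 0 < r → 0 < K r) ∧ ContDiffOn ℝ 1 K (Ioi 0) ∧
  (∀ r : ℝ, 0 < r → 0 < p + r * deriv K r / K r) ∧
  AntitoneOn (fun r => p + r * deriv K r / K r) (Ioi 0)

/-- (f1): `f(0)=0`, `f>0` above `u₀`, `f≤0` and not identically `0` on `(0,u₀)`. -/
def CondF1 (f : ℝ → ℝ) (u₀ : ℝ) : Prop :=
  f 0 = 0 ∧ (∀ v : ℝ, u₀ < v → 0 < f v) ∧ (∀ v ∈ Ioo 0 u₀, f v ≤ 0) ∧
  ∃ v ∈ Ioo 0 u₀, f v ≠ 0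

/-- (f2): `f` is continuous on `[0,∞)` and locally Lipschitz on `[u₀,∞)`. -/
def CondF2 (f : ℝ → ℝ) (u₀ : ℝ) : Prop :=
  ContinuousOn f (Ici 0) ∧ LocallyLipschitzOn (Ici u₀) f

/-- `D`: the set of differentiability points of `f` within `[u₀,∞)`. -/
def Dset (f : ℝ → ℝ) (u₀ : ℝ) : Set ℝ :=
  {v | v ∈ Ici u₀ ∧ DifferentiableWithinAt ℝ f (Ici u₀) v}

/-- the (one-sided) derivative `f'` of `f` on `[u₀,∞)`. -/
def fder (f : ℝ → ℝ) (u₀ : ℝ) (v : ℝ) : ℝ := derivWithin f (Ici u₀) v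

/-- (f3): `(p-1)f(u) ≤ f'(u)(u-u₀)` on `D`. -/
def CondF3 (p : ℝ) (f : ℝ → ℝ) (u₀ : ℝ) : Prop :=
  ∀ v ∈ Dset f u₀, (p - 1) * f v ≤ fder f u₀ v * (v - u₀)

/-- (f4): `u ↦ u·f'(u)/f(u)` is decreasing on `D`. -/
def CondF4 (f : ℝ → ℝ) (u₀ : ℝ) : Prop :=
  AntitoneOn (fun v => v * fder f u₀ v / f v) (Dset f u₀)

/-- `u` is a solution of the radial equation
`(r^{n-1} φ_p(u'))' = -r^{n-1} K(r) f(u)` on the interval `I ⊆ [0,∞)`, `0 ∈ I`: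
`u ∈ C¹(I)`, `r ↦ r^{n-1} φ_p(u'(r))` is `C¹` on `I` and the equation holds for `r ∈ I`, `r>0`. -/
def IsRadialSolution (p : ℝ) (n : ℕ) (K f : ℝ → ℝ) (I : Set ℝ) (u : ℝ → ℝ) : Prop :=
  (0:ℝ) ∈ I ∧ I ⊆ Ici 0 ∧
  ContDiffOn ℝ 1 u I ∧
  ContDiffOn ℝ 1 (fun r => r ^ (n - 1) * phiP p (derivWithin u I r)) I ∧
  ∀ r ∈ I, 0 < r →
    HasDerivWithinAt (fun r => r ^ (n - 1) * phiP p (derivWithin u I r))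
      (-(r ^ (n - 1) * K r * f (u r))) I r

/-- `F(s) = ∫₀^s f(t) dt`. -/
def Fint (f : ℝ → ℝ) (s : ℝ) : ℝ := ∫ t in (0:ℝ)..s, f t

/-- the derivative `u'` of a solution defined on `[0,∞)` (one-sided at `0`). -/
def uderiv (u : ℝ → ℝ) : ℝ → ℝ := derivWithin u (Ici 0)

/-- `R(α) = sup {r>0 : u(t,α)>0 and u'(t,α)<0 for all t ∈ (0,r)}`,
as an extended nonnegative real (it may be `∞`). -/
def Rend (u : ℝ → ℝ) : ℝ≥0∞ :=
  sSup {R : ℝ≥0∞ | ∀ t : ℝ, 0 < t → ENNReal.ofReal t < R → 0 < u t ∧ uderiv u t < 0}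

/-- the filter describing the approach `r → R⁻` to the right endpoint `R`
(`r → ∞` when `R = ∞`). -/
def endFilter (R : ℝ≥0∞) : Filter ℝ :=
  if R = ⊤ then atTop else 𝓝[<] R.toReal

/-- `u : α ↦ u(·,α)` is the family of solutions of the initial value problems
(`u(0,α)=α`, `u'(0,α)=0`) for `α > u₀`, depending continuously on `(α,r)`
together with its derivative. -/
def IsFamily (p : ℝ) (n : ℕ) (K f : ℝ → ℝ) (u₀ : ℝ) (u : ℝ → ℝ → ℝ) : Prop :=
  (∀ α : ℝ, u₀ < α →
    IsRadialSolution p n K f (Ici 0) (u α) ∧ u α 0 = α ∧ uderiv (u α) 0 = 0) ∧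
  ContinuousOn (fun q : ℝ × ℝ => u q.1 q.2) (Ioi u₀ ×ˢ Ici 0) ∧
  ContinuousOn (fun q : ℝ × ℝ => uderiv (u q.1) q.2) (Ioi u₀ ×ˢ Ici 0)

/-- the set `N` of initial values of crossing solutions; here `uR α` denotes the
limiting value `u(R(α),α)`. -/
def Ncross (u : ℝ → ℝ → ℝ) (uR : ℝ → ℝ) (u₀ : ℝ) : Set ℝ :=
  {α | u₀ < α ∧ uR α = 0 ∧
    ∃ L : ℝ, L < 0 ∧ Tendsto (uderiv (u α)) (endFilter (Rend (u α))) (𝓝 L)}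

/-- the set `G` of initial values of ground state solutions. -/
def Gset (u : ℝ → ℝ → ℝ) (uR : ℝ → ℝ) (u₀ : ℝ) : Set ℝ :=
  {α | u₀ < α ∧ uR α = 0 ∧
    Tendsto (uderiv (u α)) (endFilter (Rend (u α))) (𝓝 0)}

/-- the set `P` of initial values of positive solutions. -/
def Pset (uR : ℝ → ℝ) (u₀ : ℝ) : Set ℝ := {α | u₀ < α ∧ 0 < uR α}

/-- `t(s,α)`: the first point at which the solution `u(·,α)` takes the value `s`
(the unique `r ∈ [0,R(α))` with `u(r,α)=s` when `s` is attained there). -/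
def tInv (u : ℝ → ℝ) (s : ℝ) : ℝ := sInf {r : ℝ | 0 ≤ r ∧ u r = s}

/-- The regularity and the flux identity of a radial solution on `[0,∞)` with `u'(0) = 0`,
in terms of two-sided derivatives at positive radii; here `k = n - 1`. -/
structure RadialProfile (p : ℝ) (k : ℕ) (K f u : ℝ → ℝ) : Prop where
  cont : ContinuousOn u (Ici 0)
  cont_deriv : ContinuousOn (uderiv u) (Ici 0)
  hasDeriv : ∀ r : ℝ, 0 < r → HasDerivAt u (uderiv u r) r
  cont_flux : ContinuousOn (fun r => r ^ k * phiP p (uderiv u r)) (Ici 0)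
  hasDeriv_flux : ∀ r : ℝ, 0 < r →
    HasDerivAt (fun r => r ^ k * phiP p (uderiv u r)) (-(r ^ k * K r * f (u r))) r
  deriv_zero : uderiv u 0 = 0

/-- `u` is positive and strictly decreasing, with negative derivative, at `t`. -/
def GoodAt (u : ℝ → ℝ) (t : ℝ) : Prop := 0 < u t ∧ uderiv u t < 0

theorem IsRadialSolution.radialProfile {p : ℝ} {n : ℕ} {K f u : ℝ → ℝ}
    (h : IsRadialSolution p n K f (Ici 0) u) (h0 : uderiv u 0 = 0) :
    RadialProfile p (n - 1) K f u := by
  obtain ⟨-, -, h1, h2, h3⟩ := h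
  refine ⟨h1.continuousOn, ?_, ?_, h2.continuousOn, ?_, h0⟩
  · exact h1.continuousOn_derivWithin (uniqueDiffOn_Ici 0) le_rfl
  · intro r hr
    have := (h1.differentiableOn one_ne_zero r hr.le).hasDerivWithinAt
    exact this.hasDerivAt (Ici_mem_nhds hr)
  · intro r hr
    exact (h3 r hr.le hr).hasDerivAt (Ici_mem_nhds hr)

section PhiP

variable {p s : ℝ}

theorem phiP_zero : phiP p 0 = 0 := by simp [phiP]

theorem phiP_of_neg (hs : s < 0) : phiP p s = -(-s) ^ (p - 1) := by
  have h : (0 : ℝ) < -s := by linarith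
  have h1 : (-s) ^ (p - 1) = (-s) ^ (p - 2) * (-s) := by
    rw [← Real.rpow_add_one h.ne']; ring_nf
  rw [phiP, abs_of_neg hs, h1]; ring

theorem phiP_neg_iff : phiP p s < 0 ↔ s < 0 := by
  refine ⟨fun h => ?_, fun h => ?_⟩
  · by_contra! hs
    have : 0 ≤ phiP p s := mul_nonneg (Real.rpow_nonneg (abs_nonneg _) _) hs
    linarith
  · rw [phiP_of_neg h]
    have : 0 < (-s) ^ (p - 1) := Real.rpow_pos_of_pos (by linarith) _
    linarith

end PhiP

section Rend

variable {u : ℝ → ℝ}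

theorem goodAt_of_lt_Rend {t : ℝ} (ht : 0 < t) (h : ENNReal.ofReal t < Rend u) : GoodAt u t := by
  obtain ⟨R, hR, htR⟩ := lt_sSup_iff.1 h
  exact hR t ht htR

theorem le_Rend {ρ : ℝ} (h : ∀ t ∈ Ioo 0 ρ, GoodAt u t) : ENNReal.ofReal ρ ≤ Rend u := by
  refine le_sSup fun t ht htR => h t ⟨ht, ?_⟩
  exact (ENNReal.ofReal_lt_ofReal_iff_of_nonneg ht.le).1 htR

theorem Rend_eq {ρ : ℝ} (hρ : 0 < ρ) (h : ∀ t ∈ Ioo 0 ρ, GoodAt u t) (hn : ¬ GoodAt u ρ) :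
    Rend u = ENNReal.ofReal ρ := by
  refine le_antisymm ?_ (le_Rend h)
  by_contra! hlt
  exact hn (goodAt_of_lt_Rend hρ hlt)

theorem endFilter_neBot (R : ℝ≥0∞) : (endFilter R).NeBot := by
  unfold endFilter
  split_ifs <;> infer_instance

theorem endFilter_ofReal {ρ : ℝ} (hρ : 0 ≤ ρ) : endFilter (ENNReal.ofReal ρ) = 𝓝[<] ρ := by
  simp [endFilter, ENNReal.toReal_ofReal hρ]

theorem endFilter_top : endFilter ⊤ = atTop := by simp [endFilter]

theorem eventually_endFilter {R : ℝ≥0∞} {a : ℝ} (ha : 0 ≤ a) (h : ENNReal.ofReal a < R) :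
    ∀ᶠ r in endFilter R, a < r ∧ ENNReal.ofReal r < R := by
  by_cases hR : R = ⊤
  · subst hR
    rw [endFilter_top]
    filter_upwards [eventually_gt_atTop a] with r hr using ⟨hr, ENNReal.ofReal_lt_top⟩
  · have haR : a < R.toReal := (ENNReal.ofReal_lt_iff_lt_toReal ha hR).1 h
    rw [endFilter, if_neg hR]
    filter_upwards [Ioo_mem_nhdsLT haR] with r hr
    exact ⟨hr.1, (ENNReal.ofReal_lt_iff_lt_toReal (ha.trans hr.1.le) hR).2 hr.2⟩

end Rend

namespace RadialProfile

variable {p u₀ : ℝ} {k : ℕ} {K f u : ℝ → ℝ}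

theorem continuousAt (h : RadialProfile p k K f u) {r : ℝ} (hr : 0 < r) : ContinuousAt u r :=
  h.cont.continuousAt (Ici_mem_nhds hr)

theorem continuousAt_deriv (h : RadialProfile p k K f u) {r : ℝ} (hr : 0 < r) :
    ContinuousAt (uderiv u) r :=
  h.cont_deriv.continuousAt (Ici_mem_nhds hr)

theorem flux_neg_iff {r : ℝ} (hr : 0 < r) :
    r ^ k * phiP p (uderiv u r) < 0 ↔ uderiv u r < 0 := by
  rw [← phiP_neg_iff (p := p) (s := uderiv u r), ← not_le,
    mul_nonneg_iff_of_pos_left (pow_pos hr k), not_le]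

theorem uderiv_neg (h : RadialProfile p k K f u) (hK : ∀ r : ℝ, 0 < r → 0 < K r)
    (hf : ∀ v : ℝ, u₀ < v → 0 < f v) {δ : ℝ} (hδ : ∀ t ∈ Ioo 0 δ, u₀ < u t) :
    ∀ t ∈ Ioc 0 δ, uderiv u t < 0 := by
  intro t ht
  have hanti : StrictAntiOn (fun r => r ^ k * phiP p (uderiv u r)) (Icc 0 δ) := by
    refine strictAntiOn_of_deriv_neg (convex_Icc 0 δ) (h.cont_flux.mono fun x hx => hx.1) ?_
    intro x hx
    rw [interior_Icc] at hx
    rw [(h.hasDeriv_flux x hx.1).deriv]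
    have := mul_pos (mul_pos (pow_pos hx.1 k) (hK x hx.1)) (hf _ (hδ x hx))
    linarith
  have := hanti ⟨le_rfl, ht.1.le.trans ht.2⟩ ⟨ht.1.le, ht.2⟩ ht.1
  simp only [h.deriv_zero, phiP_zero, mul_zero] at this
  exact (flux_neg_iff ht.1).1 this

theorem exists_gt_near_zero (h : RadialProfile p k K f u) (h0 : u₀ < u 0) :
    ∃ δ > 0, ∀ t ∈ Icc 0 δ, u₀ < u t := by
  have : ∀ᶠ t in 𝓝[≥] (0 : ℝ), u₀ < u t := (h.cont 0 self_mem_Ici).eventually_const_lt h0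
  obtain ⟨δ, hδ, hs⟩ := (mem_nhdsGE_iff_exists_Icc_subset).1 this
  exact ⟨δ, hδ, hs⟩

theorem Rend_pos (h : RadialProfile p k K f u) (hK : ∀ r : ℝ, 0 < r → 0 < K r)
    (hf : ∀ v : ℝ, u₀ < v → 0 < f v) (hu₀ : 0 < u₀) (h0 : u₀ < u 0) : 0 < Rend u := by
  obtain ⟨δ, hδ, hs⟩ := h.exists_gt_near_zero h0
  refine (ENNReal.ofReal_pos.2 hδ).trans_le (le_Rend fun t ht => ⟨?_, ?_⟩)
  · exact hu₀.trans (hs t ⟨ht.1.le, ht.2.le⟩)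
  · exact h.uderiv_neg hK hf (fun t ht => hs t ⟨ht.1.le, ht.2.le⟩) t ⟨ht.1, ht.2.le⟩

/-- Description of the endpoint `R` when it is finite. -/
theorem finite_end (h : RadialProfile p k K f u) (hR0 : 0 < Rend u) (hR : Rend u ≠ ⊤) :
    ∃ ρ > 0, Rend u = ENNReal.ofReal ρ ∧ (∀ t ∈ Ioo 0 ρ, GoodAt u t) ∧
      0 ≤ u ρ ∧ uderiv u ρ ≤ 0 ∧ ¬ GoodAt u ρ := by
  have hρ : 0 < (Rend u).toReal := ENNReal.toReal_pos hR0.ne' hR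
  have hRρ : Rend u = ENNReal.ofReal (Rend u).toReal := (ENNReal.ofReal_toReal hR).symm
  set ρ := (Rend u).toReal
  have hgood : ∀ t ∈ Ioo 0 ρ, GoodAt u t := fun t ht =>
    goodAt_of_lt_Rend ht.1 (by rw [hRρ]; exact (ENNReal.ofReal_lt_ofReal_iff hρ).2 ht.2)
  have hev : ∀ᶠ t in 𝓝[<] ρ, GoodAt u t := by
    filter_upwards [Ioo_mem_nhdsLT hρ] with t ht using hgood t ht
  refine ⟨ρ, hρ, hRρ, hgood, ?_, ?_, ?_⟩
  · exact ge_of_tendsto ((h.continuousAt hρ).mono_left nhdsWithin_le_nhds)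
      (hev.mono fun t ht => ht.1.le)
  · exact le_of_tendsto ((h.continuousAt_deriv hρ).mono_left nhdsWithin_le_nhds)
      (hev.mono fun t ht => ht.2.le)
  · intro hg
    have h1 : ∀ᶠ t in 𝓝 ρ, GoodAt u t :=
      ((h.continuousAt hρ).eventually_const_lt hg.1).and
        ((h.continuousAt_deriv hρ).eventually_lt_const hg.2)
    obtain ⟨ε, hε, hball⟩ := Metric.eventually_nhds_iff.1 h1
    have : ENNReal.ofReal (ρ + ε) ≤ Rend u := by
      refine le_Rend fun t ht => ?_
      rcases lt_or_ge t ρ with hlt | hge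
      · exact hgood t ⟨ht.1, hlt⟩
      · refine hball ?_
        rw [Real.dist_eq, abs_of_nonneg (by linarith)]
        linarith [ht.2]
    rw [hRρ, ENNReal.ofReal_le_ofReal_iff hρ.le] at this
    linarith

theorem strictAntiOn (h : RadialProfile p k K f u) {b : ℝ}
    (hb : ∀ t ∈ Ioo 0 b, uderiv u t < 0) : StrictAntiOn u (Icc 0 b) := by
  refine strictAntiOn_of_deriv_neg (convex_Icc 0 b) (h.cont.mono fun x hx => hx.1) ?_
  intro x hx
  rw [interior_Icc] at hx
  rw [(h.hasDeriv x hx.1).deriv]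
  exact hb x hx

/-- Below the level `u₀` the flux is monotone, which bounds the remaining decrease of `u`. -/
theorem drop_bound (h : RadialProfile p k K f u) (hK : ∀ r : ℝ, 0 < r → 0 < K r)
    (hf : ∀ v ∈ Ioo 0 u₀, f v ≤ 0) (hp : 1 < p) (hpk : p < k + 1) {a b : ℝ} (ha : 0 < a)
    (hab : a ≤ b) (hua : u a < u₀) (hgood : ∀ t ∈ Ioc 0 b, GoodAt u t) :
    u a - a * -uderiv u a * ((p - 1) / (k + 1 - p)) ≤ u b := by
  have hanti := h.strictAntiOn (b := b) fun t ht => (hgood t ⟨ht.1, ht.2.le⟩).2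
  have hflux : MonotoneOn (fun r => r ^ k * phiP p (uderiv u r)) (Icc a b) := by
    refine monotoneOn_of_deriv_nonneg (convex_Icc a b)
      (h.cont_flux.mono fun x hx => ha.le.trans hx.1) ?_ ?_
    · intro x hx
      rw [interior_Icc] at hx
      exact (h.hasDeriv_flux x (ha.trans hx.1)).differentiableAt.differentiableWithinAt
    · intro x hx
      rw [interior_Icc] at hx
      have hx0 : 0 < x := ha.trans hx.1
      rw [(h.hasDeriv_flux x hx0).deriv]
      have hux : u x < u a := hanti ⟨ha.le, hab⟩ ⟨hx0.le, hx.2.le⟩ hx.1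
      have h1 := hf (u x) ⟨(hgood x ⟨hx0, hx.2.le⟩).1, hux.trans hua⟩
      have h2 := mul_pos (pow_pos hx0 k) (hK x hx0)
      nlinarith
  set κ : ℝ := k / (p - 1) with hκ
  have hp1 : 0 < p - 1 := by linarith
  have hκ1 : 1 < κ := by rw [hκ, lt_div_iff₀ hp1]; linarith
  set c : ℝ := -uderiv u a with hc
  have hc0 : 0 < c := by have := (hgood a ⟨ha, hab⟩).2; linarith
  have hderiv : ∀ x ∈ Icc a b, -(c * a ^ κ * x ^ (-κ)) ≤ uderiv u x := by
    intro x hx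
    have hx0 : 0 < x := ha.trans_le hx.1
    have hgx := (hgood x ⟨hx0, hx.2⟩).2
    have h1 := hflux ⟨le_rfl, hab⟩ hx hx.1
    simp only [phiP_of_neg (hgood a ⟨ha, hab⟩).2, phiP_of_neg hgx] at h1
    have h2 : x ^ k * (-uderiv u x) ^ (p - 1) ≤ a ^ k * c ^ (p - 1) := by linarith
    have hd0 : 0 < -uderiv u x := by linarith
    have key : ∀ y z : ℝ, 0 < y → 0 < z →
        (y ^ k * z ^ (p - 1)) ^ (1 / (p - 1)) = y ^ κ * z := by
      intro y z hy hz
      rw [Real.mul_rpow (pow_pos hy k).le (Real.rpow_nonneg hz.le _), ← Real.rpow_natCast,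
        ← Real.rpow_mul hy.le, ← Real.rpow_mul hz.le, mul_one_div_cancel hp1.ne', Real.rpow_one,
        mul_one_div]
    have h3 := Real.rpow_le_rpow (by positivity) h2 (one_div_pos.2 hp1).le
    rw [key x _ hx0 hd0, key a c ha hc0] at h3
    rw [Real.rpow_neg hx0.le, ← div_eq_mul_inv, neg_le]
    rw [le_div_iff₀ (Real.rpow_pos_of_pos hx0 _)]
    linarith
  set A : ℝ := c * a ^ κ / (κ - 1) with hA
  have hmono : MonotoneOn (fun x => u x - A * x ^ (1 - κ)) (Icc a b) := by
    have hd : ∀ x, 0 < x → HasDerivAt (fun x => u x - A * x ^ (1 - κ))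
        (uderiv u x - A * ((1 - κ) * x ^ (1 - κ - 1))) x := fun x hx =>
      (h.hasDeriv x hx).sub ((Real.hasDerivAt_rpow_const (Or.inl hx.ne')).const_mul A)
    refine monotoneOn_of_deriv_nonneg (convex_Icc a b)
      (fun x hx => (hd x (ha.trans_le hx.1)).continuousAt.continuousWithinAt)
      (fun x hx => ?_) (fun x hx => ?_)
    · rw [interior_Icc] at hx
      exact (hd x (ha.trans hx.1)).differentiableAt.differentiableWithinAt
    · rw [interior_Icc] at hx
      rw [(hd x (ha.trans hx.1)).deriv]
      have h1 := hderiv x ⟨hx.1.le, hx.2.le⟩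
      have h2 : A * ((1 - κ) * x ^ (1 - κ - 1)) = -(c * a ^ κ * x ^ (-κ)) := by
        have h4 : κ - 1 ≠ 0 := by linarith
        rw [show 1 - κ - 1 = -κ by ring, hA]
        field_simp
        ring
      linarith
  have h1 := hmono ⟨le_rfl, hab⟩ ⟨hab, le_rfl⟩ hab
  have hκ0 : 0 < κ - 1 := by linarith
  have hA0 : 0 < A := div_pos (mul_pos hc0 (Real.rpow_pos_of_pos ha _)) hκ0
  have h2 : 0 < A * b ^ (1 - κ) := mul_pos hA0 (Real.rpow_pos_of_pos (ha.trans_le hab) _)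
  have h3 : A * a ^ (1 - κ) = a * c * ((p - 1) / (k + 1 - p)) := by
    have h4 : a ^ κ * a ^ (1 - κ) = a := by
      rw [← Real.rpow_add ha]; simp
    have h5 : (p - 1) / (k + 1 - p) = 1 / (κ - 1) := by
      have : (k : ℝ) + 1 - p ≠ 0 := by linarith
      rw [eq_div_iff hκ0.ne', hκ]
      field_simp
      ring
    rw [h5, hA]
    calc c * a ^ κ / (κ - 1) * a ^ (1 - κ) = c * (a ^ κ * a ^ (1 - κ)) / (κ - 1) := by ring
      _ = a * c * (1 / (κ - 1)) := by rw [h4]; ring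
  simp only at h1
  linarith

/-- A positive decreasing profile on `(0,∞)` satisfies `liminf r |u'(r)| = 0`. -/
theorem exists_small_slope (h : RadialProfile p k K f u) (hgood : ∀ t > 0, GoodAt u t)
    {ε : ℝ} (hε : 0 < ε) (M : ℝ) : ∃ r, M < r ∧ 0 < r ∧ r * -uderiv u r < ε := by
  by_contra! hcon
  set m := max M 0 + 1
  have hm : 0 < m := by positivity
  have hmM : M < m := by have := le_max_left M 0; simp only [m]; linarith
  have hanti : AntitoneOn (fun x => u x + ε * Real.log x) (Ici m) := by
    have hd : ∀ x, 0 < x → HasDerivAt (fun x => u x + ε * Real.log x)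
        (uderiv u x + ε * x⁻¹) x := fun x hx =>
      (h.hasDeriv x hx).add ((Real.hasDerivAt_log hx.ne').const_mul ε)
    refine antitoneOn_of_deriv_nonpos (convex_Ici m)
      (fun x hx => (hd x (hm.trans_le hx)).continuousAt.continuousWithinAt)
      (fun x hx => ?_) (fun x hx => ?_)
    · rw [interior_Ici] at hx
      exact (hd x (hm.trans hx)).differentiableAt.differentiableWithinAt
    · rw [interior_Ici] at hx
      have hx0 : 0 < x := hm.trans hx
      rw [(hd x hx0).deriv]
      have := hcon x (hmM.trans hx) hx0
      rw [mul_comm, ← div_le_iff₀ hx0, div_eq_mul_inv] at this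
      linarith
  have hlog : Tendsto (fun x => ε * Real.log x) atTop atTop :=
    Real.tendsto_log_atTop.const_mul_atTop hε
  obtain ⟨x, hx1, hx2⟩ :=
    ((hlog.eventually_gt_atTop (u m + ε * Real.log m)).and (eventually_ge_atTop m)).exists
  have h1 := hanti self_mem_Ici hx2 hx2
  have h2 := (hgood x (hm.trans_le hx2)).1
  simp only at h1
  linarith

end RadialProfile

section Weight

variable {p : ℝ} {K : ℝ → ℝ}

theorem CondK1.hasDerivAt (hK : CondK1 p K) {r : ℝ} (hr : 0 < r) :
    HasDerivAt K (deriv K r) r :=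
  ((hK.2.1.differentiableOn one_ne_zero).differentiableAt (Ioi_mem_nhds hr)).hasDerivAt

theorem CondK1.deriv_bound (hK : CondK1 p K) {r : ℝ} (hr : 0 < r) :
    0 < p * K r + r * deriv K r := by
  have h1 := hK.2.2.1 r hr
  have h2 := hK.1 r hr
  have h3 := mul_pos h1 h2
  rwa [add_mul, div_mul_cancel₀ _ h2.ne'] at h3

theorem CondK1.monotoneOn (hK : CondK1 p K) : MonotoneOn (fun r => r ^ p * K r) (Ioi 0) := by
  have hd : ∀ x, 0 < x → HasDerivAt (fun r => r ^ p * K r)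
      (p * x ^ (p - 1) * K x + x ^ p * deriv K x) x := fun x hx =>
    (Real.hasDerivAt_rpow_const (Or.inl hx.ne')).mul (hK.hasDerivAt hx)
  refine monotoneOn_of_deriv_nonneg (convex_Ioi 0)
    (fun x hx => (hd x hx).continuousAt.continuousWithinAt)
    (fun x hx => ?_) (fun x hx => ?_)
  · rw [interior_Ioi] at hx
    exact (hd x hx).differentiableAt.differentiableWithinAt
  · rw [interior_Ioi] at hx
    rw [(hd x hx).deriv]
    have h1 : x ^ p = x ^ (p - 1) * x := by
      rw [← Real.rpow_add_one (ne_of_gt hx)]; ring_nf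
    have h2 := mul_pos (Real.rpow_pos_of_pos hx (p - 1)) (hK.deriv_bound hx)
    rw [h1]
    nlinarith

end Weight

section Primitive

variable {f : ℝ → ℝ} {u₀ : ℝ}

theorem intervalIntegrable_of_continuousOn_Ici (hf : ContinuousOn f (Ici 0)) {a b : ℝ}
    (ha : 0 ≤ a) (hb : 0 ≤ b) : IntervalIntegrable f volume a b :=
  (hf.mono fun _ hx => (le_min ha hb).trans hx.1).intervalIntegrable

theorem Fint_hasDerivAt (hf : ContinuousOn f (Ici 0)) {s : ℝ} (hs : 0 < s) :
    HasDerivAt (Fint f) (f s) s := by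
  refine intervalIntegral.integral_hasDerivAt_right
    (intervalIntegrable_of_continuousOn_Ici hf le_rfl hs.le) ?_
    (hf.continuousAt (Ici_mem_nhds hs))
  exact (hf.mono Ioi_subset_Ici_self).stronglyMeasurableAtFilter isOpen_Ioi s hs

theorem Fint_zero : Fint f 0 = 0 := by simp [Fint]

theorem Fint_continuousOn (hf : ContinuousOn f (Ici 0)) {b : ℝ} (hb : 0 ≤ b) :
    ContinuousOn (Fint f) (Icc 0 b) := by
  have := intervalIntegral.continuousOn_primitive_interval'
    (intervalIntegrable_of_continuousOn_Ici hf le_rfl hb) (left_mem_uIcc)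
  rwa [uIcc_of_le hb] at this

theorem Fint_neg (hf1 : CondF1 f u₀) (hf : ContinuousOn f (Ici 0)) (hu₀ : 0 < u₀) :
    Fint f u₀ < 0 := by
  obtain ⟨-, -, hle, c, hc, hfc⟩ := hf1
  have hcont : ContinuousOn (fun x => -f x) (Icc 0 u₀) :=
    (hf.mono fun x hx => hx.1).neg
  have hanti : AntitoneOn (Fint f) (Icc 0 u₀) := by
    refine antitoneOn_of_deriv_nonpos (convex_Icc 0 u₀) (Fint_continuousOn hf hu₀.le) ?_ ?_
    · intro x hx
      rw [interior_Icc] at hx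
      exact (Fint_hasDerivAt hf hx.1).differentiableAt.differentiableWithinAt
    · intro x hx
      rw [interior_Icc] at hx
      rw [(Fint_hasDerivAt hf hx.1).deriv]
      exact hle x hx
  by_contra! hge
  have hzero : ∀ x ∈ Icc 0 u₀, Fint f x = 0 := fun x hx => le_antisymm
    (Fint_zero (f := f) ▸ hanti ⟨le_rfl, hu₀.le⟩ hx hx.1)
    (hge.trans (hanti hx ⟨hu₀.le, le_rfl⟩ hx.2))
  have hev : Fint f =ᶠ[𝓝 c] fun _ => 0 := by
    filter_upwards [Ioo_mem_nhds hc.1 hc.2] with x hx using hzero x ⟨hx.1.le, hx.2.le⟩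
  have := (Fint_hasDerivAt hf hc.1).unique ((hasDerivAt_const c (0 : ℝ)).congr_of_eventuallyEq hev)
  exact hfc this

end Primitive

/-- The energy `(p-1)/p · |u'|^p / K + F(u)` of a radial profile. -/
def energy (p : ℝ) (K f u : ℝ → ℝ) (r : ℝ) : ℝ :=
  (p - 1) / p * ((-uderiv u r) ^ p / K r) + Fint f (u r)

namespace RadialProfile

variable {p u₀ : ℝ} {k : ℕ} {K f u : ℝ → ℝ}

theorem hasDerivAt_rpow_deriv (h : RadialProfile p k K f u) (hp : 1 < p) {r : ℝ} (hr : 0 < r)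
    (hd : uderiv u r < 0) :
    HasDerivAt (fun x => (-uderiv u x) ^ p)
      (p / (p - 1) * (-uderiv u r * (K r * f (u r)) - k / r * (-uderiv u r) ^ p)) r := by
  have hp1 : 0 < p - 1 := by linarith
  set v := -uderiv u r with hv
  have hv0 : 0 < v := by linarith
  have hpow : 0 < r ^ k := pow_pos hr k
  have hW : HasDerivAt (fun x => -(x ^ k * phiP p (uderiv u x)) / x ^ k)
      ((-(-(r ^ k * K r * f (u r))) * r ^ k
        - -(r ^ k * phiP p (uderiv u r)) * (k * r ^ (k - 1))) / (r ^ k) ^ 2) r :=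
    (h.hasDeriv_flux r hr).neg.div (hasDerivAt_pow k r) hpow.ne'
  have hWr : -(r ^ k * phiP p (uderiv u r)) / r ^ k = v ^ (p - 1) := by
    rw [phiP_of_neg hd, ← hv]; field_simp
  have hWd : ((-(-(r ^ k * K r * f (u r))) * r ^ k
        - -(r ^ k * phiP p (uderiv u r)) * (k * r ^ (k - 1))) / (r ^ k) ^ 2)
      = K r * f (u r) - k / r * v ^ (p - 1) := by
    have h1 : (k : ℝ) * r ^ (k - 1) = k / r * r ^ k := by
      rcases k with _ | j
      · simp
      · rw [Nat.add_sub_cancel, pow_succ]; field_simp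
    rw [h1, phiP_of_neg hd]
    field_simp
    ring
  rw [hWd] at hW
  have hcomp := hW.rpow_const (p := p / (p - 1)) (Or.inl (by
    rw [hWr]; exact (Real.rpow_pos_of_pos hv0 _).ne'))
  rw [hWr] at hcomp
  have e1 : (v ^ (p - 1)) ^ (p / (p - 1) - 1) = v := by
    rw [← Real.rpow_mul hv0.le]
    have : (p - 1) * (p / (p - 1) - 1) = 1 := by field_simp; ring
    rw [this, Real.rpow_one]
  have e2 : v ^ p = v * v ^ (p - 1) := by
    rw [mul_comm, ← Real.rpow_add_one hv0.ne']; ring_nf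
  rw [e1] at hcomp
  have heq : (fun x => (-uderiv u x) ^ p) =ᶠ[𝓝 r]
      fun x => (-(x ^ k * phiP p (uderiv u x)) / x ^ k) ^ (p / (p - 1)) := by
    filter_upwards [Ioi_mem_nhds hr, (h.continuousAt_deriv hr).eventually_lt_const hd] with x hx hdx
    have hx' : 0 < x ^ k := pow_pos hx k
    have h1 : -(x ^ k * phiP p (uderiv u x)) / x ^ k = (-uderiv u x) ^ (p - 1) := by
      rw [phiP_of_neg hdx]; field_simp
    rw [h1, ← Real.rpow_mul (by linarith), mul_div_cancel₀ _ hp1.ne']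
  refine (hcomp.congr_of_eventuallyEq heq).congr_deriv ?_
  rw [e2]
  ring

theorem energy_antitone (h : RadialProfile p k K f u) (hK : CondK1 p K)
    (hf : ContinuousOn f (Ici 0)) (hp : 1 < p) (hpk : p < k + 1) {a b : ℝ} (ha : 0 < a)
    (hab : a ≤ b) (hgood : ∀ t ∈ Icc a b, GoodAt u t) : energy p K f u b ≤ energy p K f u a := by
  have hp1 : 0 < p - 1 := by linarith
  have hd : ∀ x ∈ Icc a b, ∃ d ≤ 0, HasDerivAt (energy p K f u) d x := by
    intro x hx
    have hx0 : 0 < x := ha.trans_le hx.1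
    obtain ⟨hux, hdx⟩ := hgood x hx
    have hKx := hK.1 x hx0
    refine ⟨_, ?_, (((h.hasDerivAt_rpow_deriv hp hx0 hdx).div (hK.hasDerivAt hx0)
      hKx.ne').const_mul ((p - 1) / p)).add
      ((Fint_hasDerivAt hf hux).comp x (h.hasDeriv x hx0))⟩
    have hV : 0 < (-uderiv u x) ^ p := Real.rpow_pos_of_pos (by linarith) _
    set V := (-uderiv u x) ^ p
    have hp0 : p ≠ 0 := by linarith
    have e : (p - 1) / p * ((p / (p - 1) * (-uderiv u x * (K x * f (u x)) - k / x * V) * K x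
        - V * deriv K x) / K x ^ 2) + f (u x) * uderiv u x
        = -(V / (p * x * K x ^ 2)) * (p * k * K x + (p - 1) * (x * deriv K x)) := by
      field_simp
      ring
    rw [e]
    have h1 : 0 < V / (p * x * K x ^ 2) := by positivity
    have h2 := mul_pos hp1 (hK.deriv_bound hx0)
    have h3 : 0 < p * (k + 1 - p) * K x := mul_pos (mul_pos (by linarith) (by linarith)) hKx
    have h4 : 0 ≤ p * k * K x + (p - 1) * (x * deriv K x) := by nlinarith
    nlinarith [mul_nonneg h1.le h4]
  have hanti : AntitoneOn (energy p K f u) (Icc a b) := by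
    refine antitoneOn_of_deriv_nonpos (convex_Icc a b) (fun x hx => ?_) (fun x hx => ?_)
      (fun x hx => ?_)
    · obtain ⟨d, -, hd⟩ := hd x hx
      exact hd.continuousAt.continuousWithinAt
    · obtain ⟨d, -, hd⟩ := hd x (interior_subset hx)
      exact hd.differentiableAt.differentiableWithinAt
    · obtain ⟨d, hd0, hd⟩ := hd x (interior_subset hx)
      rwa [hd.deriv]
  exact hanti ⟨le_rfl, hab⟩ ⟨hab, le_rfl⟩ hab

/-- A profile that decreases on all of `(0,∞)` has a limit at most `u₀`. -/
theorem limit_le (h : RadialProfile p k K f u) (hK : CondK1 p K) (hf1 : CondF1 f u₀)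
    (hf : ContinuousOn f (Ici 0)) (hp : 1 < p) (hpk : p < k + 1) (hu₀ : 0 < u₀)
    (hgood : ∀ t > 0, GoodAt u t) {l : ℝ} (hl : Tendsto u atTop (𝓝 l)) : l ≤ u₀ := by
  by_contra! hlt
  have hl0 : 0 < l := hu₀.trans hlt
  have hp1 : 0 < p - 1 := by linarith
  have hq : 0 < (k : ℝ) + 1 - p := by linarith
  have hfl := hf1.2.1 l hlt
  set m := f l / 2 with hm
  have hm0 : 0 < m := by positivity
  have hev : ∀ᶠ r in atTop, m < f (u r) :=
    ((hf.continuousAt (Ici_mem_nhds hl0)).tendsto.comp hl).eventually_const_lt (by linarith)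
  obtain ⟨M, hM⟩ := eventually_atTop.1 hev
  set N := max M 1
  have hN1 : 1 ≤ N := le_max_right _ _
  have hN0 : 0 < N := by linarith
  have hK1 := hK.1 1 one_pos
  set c := m * K 1 / (k + 1 - p) with hc
  have hc0 : 0 < c := by positivity
  have hanti : AntitoneOn
      (fun r => r ^ k * phiP p (uderiv u r) + c * r ^ ((k : ℝ) + 1 - p)) (Ici N) := by
    have hd : ∀ x, 0 < x → HasDerivAt
        (fun r => r ^ k * phiP p (uderiv u r) + c * r ^ ((k : ℝ) + 1 - p))
        (-(x ^ k * K x * f (u x)) + c * ((k + 1 - p) * x ^ ((k : ℝ) + 1 - p - 1))) x := fun x hx =>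
      (h.hasDeriv_flux x hx).add ((Real.hasDerivAt_rpow_const (Or.inl hx.ne')).const_mul c)
    refine antitoneOn_of_deriv_nonpos (convex_Ici N)
      (fun x hx => (hd x (hN0.trans_le hx)).continuousAt.continuousWithinAt)
      (fun x hx => ?_) (fun x hx => ?_)
    · rw [interior_Ici] at hx
      exact (hd x (hN0.trans hx)).differentiableAt.differentiableWithinAt
    · rw [interior_Ici] at hx
      have hx0 : 0 < x := hN0.trans hx
      rw [(hd x hx0).deriv]
      have hfx : m < f (u x) := hM x ((le_max_left _ _).trans (le_of_lt hx))
      have hKx := hK.monotoneOn (mem_Ioi.2 one_pos) hx0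
        (hN1.trans (le_of_lt hx))
      simp only [Real.one_rpow, one_mul] at hKx
      have e1 : c * ((k + 1 - p) * x ^ ((k : ℝ) + 1 - p - 1)) = m * K 1 * x ^ ((k : ℝ) - p) := by
        rw [show (k : ℝ) + 1 - p - 1 = k - p by ring, hc]; field_simp
      have e2 : x ^ k * K x = x ^ ((k : ℝ) - p) * (x ^ p * K x) := by
        rw [← mul_assoc, ← Real.rpow_add hx0, sub_add_cancel, Real.rpow_natCast]
      rw [e1, e2]
      have h1 : 0 < x ^ ((k : ℝ) - p) := Real.rpow_pos_of_pos hx0 _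
      have h2 : K 1 * m ≤ (x ^ p * K x) * f (u x) :=
        mul_le_mul hKx hfx.le hm0.le (hK1.le.trans hKx)
      nlinarith [mul_le_mul_of_nonneg_left h2 h1.le]
  set B := N ^ k * phiP p (uderiv u N) + c * N ^ ((k : ℝ) + 1 - p)
  have hB := (tendsto_rpow_atTop hq).eventually_gt_atTop (B / (c / 2))
  obtain ⟨M', hM'⟩ := eventually_atTop.1 hB
  obtain ⟨r, hrM, hr0, hr⟩ := h.exists_small_slope hgood
    (ε := (c / 2) ^ (1 / (p - 1))) (by positivity) (max N M')
  have hrN : N ≤ r := (le_max_left _ _).trans hrM.le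
  have h1 := hanti self_mem_Ici hrN hrN
  have h2 := hM' r ((le_max_right _ _).trans hrM.le)
  rw [div_lt_iff₀ (by positivity)] at h2
  have hdr := (hgood r hr0).2
  have hv0 : 0 < -uderiv u r := by linarith
  have h3 : (r * -uderiv u r) ^ (p - 1) < c / 2 := by
    have := Real.rpow_lt_rpow (by positivity) hr hp1
    rwa [← Real.rpow_mul (by positivity), one_div_mul_cancel hp1.ne', Real.rpow_one] at this
  have h4 : r ^ k * phiP p (uderiv u r)
      = -(r ^ ((k : ℝ) + 1 - p) * (r * -uderiv u r) ^ (p - 1)) := by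
    rw [phiP_of_neg hdr, Real.mul_rpow hr0.le hv0.le, ← mul_assoc, ← Real.rpow_add hr0,
      show (k : ℝ) + 1 - p + (p - 1) = k by ring, Real.rpow_natCast]
    ring
  have h5 : 0 < r ^ ((k : ℝ) + 1 - p) := Real.rpow_pos_of_pos hr0 _
  simp only [h4] at h1
  nlinarith [mul_lt_mul_of_pos_left h3 h5]

/-- If a finite endpoint is reached with zero slope, the value there is below `u₀`. -/
theorem end_value_lt (h : RadialProfile p k K f u) (hK : CondK1 p K) (hf1 : CondF1 f u₀)
    {ρ : ℝ} (hρ : 0 < ρ) (hgood : ∀ t ∈ Ioo 0 ρ, GoodAt u t) (hd : uderiv u ρ = 0) :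
    u ρ < u₀ := by
  by_contra! hge
  have hanti := h.strictAntiOn fun t ht => (hgood t ht).2
  have := h.uderiv_neg hK.1 hf1.2.1 (δ := ρ) (fun t ht =>
    hge.trans_lt (hanti ⟨ht.1.le, ht.2.le⟩ ⟨hρ.le, le_rfl⟩ ht.2)) ρ ⟨hρ, le_rfl⟩
  linarith

/-- A positive limit follows from positivity on `[0,a]` and a uniform lower bound afterwards. -/
theorem limit_pos (h : RadialProfile p k K f u) (hR0 : 0 < Rend u) {l a m : ℝ}
    (hl : Tendsto u (endFilter (Rend u)) (𝓝 l)) (ha : 0 < a) (hm : 0 < m)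
    (hpos : ∀ t ∈ Icc 0 a, 0 < u t)
    (hlow : ∀ r, a ≤ r → (∀ t ∈ Ioc 0 r, GoodAt u t) → m ≤ u r) : 0 < l := by
  rcases le_or_gt (Rend u) (ENNReal.ofReal a) with hle | hlt
  · obtain ⟨ρ, hρ, hRρ, -⟩ := h.finite_end hR0 (hle.trans_lt ENNReal.ofReal_lt_top).ne
    rw [hRρ, endFilter_ofReal hρ.le] at hl
    have := tendsto_nhds_unique hl ((h.continuousAt hρ).mono_left nhdsWithin_le_nhds)
    rw [this]
    rw [hRρ, ENNReal.ofReal_le_ofReal_iff ha.le] at hle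
    exact hpos ρ ⟨hρ.le, hle⟩
  · have := endFilter_neBot (Rend u)
    refine hm.trans_le (ge_of_tendsto hl ?_)
    filter_upwards [eventually_endFilter ha.le hlt] with r hr
    exact hlow r hr.1.le fun t ht => goodAt_of_lt_Rend ht.1
      ((ENNReal.ofReal_le_ofReal ht.2).trans_lt hr.2)

theorem limit_pos_of_drop (h : RadialProfile p k K f u) (hK : CondK1 p K) (hf1 : CondF1 f u₀)
    (hp : 1 < p) (hpk : p < k + 1) (hR0 : 0 < Rend u) {l a : ℝ}
    (hl : Tendsto u (endFilter (Rend u)) (𝓝 l)) (ha : 0 < a)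
    (hpos : ∀ t ∈ Icc 0 a, 0 < u t) (hua : u a < u₀)
    (hdrop : 0 < u a - a * -uderiv u a * ((p - 1) / (k + 1 - p))) : 0 < l :=
  h.limit_pos hR0 hl ha hdrop hpos fun _ hr hg => h.drop_bound hK.1 hf1.2.2.1 hp hpk ha hr hua hg

theorem limit_pos_of_energy (h : RadialProfile p k K f u) (hK : CondK1 p K)
    (hf : ContinuousOn f (Ici 0)) (hp : 1 < p) (hpk : p < k + 1) (hR0 : 0 < Rend u) {l a : ℝ}
    (hl : Tendsto u (endFilter (Rend u)) (𝓝 l)) (ha : 0 < a)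
    (hpos : ∀ t ∈ Icc 0 a, 0 < u t) (hE : energy p K f u a < 0) : 0 < l := by
  have hcont := Fint_continuousOn hf zero_le_one 0 ⟨le_rfl, zero_le_one⟩
  have hev : ∀ᶠ s in 𝓝[Icc 0 1] (0 : ℝ), energy p K f u a < Fint f s :=
    hcont.eventually_const_lt (by rwa [Fint_zero])
  obtain ⟨ε, hε, hball⟩ := Metric.eventually_nhds_iff.1 (eventually_nhdsWithin_iff.1 hev)
  refine h.limit_pos hR0 hl ha (lt_min hε one_pos) hpos fun r hr hg => ?_
  by_contra! hlt
  have hr0 : 0 < r := ha.trans_le hr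
  obtain ⟨hur, hdr⟩ := hg r ⟨hr0, le_rfl⟩
  have h1 := hball (y := u r)
    (by rw [Real.dist_eq, sub_zero, abs_of_pos hur]; exact hlt.trans_le (min_le_left _ _))
    ⟨hur.le, (hlt.trans_le (min_le_right _ _)).le⟩
  have h2 := h.energy_antitone hK hf hp hpk ha hr fun t ht => hg t ⟨ha.trans_le ht.1, ht.2⟩
  have h3 : 0 ≤ (p - 1) / p * ((-uderiv u r) ^ p / K r) := by
    have := hK.1 r hr0
    have h4 : 0 < -uderiv u r := by linarith
    have h5 : 0 < p - 1 := by linarith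
    positivity
  unfold energy at h1 h2
  linarith

/-- A positive solution satisfies one of two conditions which are stable under perturbation. -/
theorem exists_drop_or_energy (h : RadialProfile p k K f u) (hK : CondK1 p K) (hf1 : CondF1 f u₀)
    (hf : ContinuousOn f (Ici 0)) (hp : 1 < p) (hpk : p < k + 1) (hu₀ : 0 < u₀)
    (hR0 : 0 < Rend u) (hu0 : u₀ < u 0) {l : ℝ}
    (hl : Tendsto u (endFilter (Rend u)) (𝓝 l)) (hl0 : 0 < l) :
    ∃ a > 0, (∀ t ∈ Icc 0 a, 0 < u t) ∧
      ((u a < u₀ ∧ 0 < u a - a * -uderiv u a * ((p - 1) / (k + 1 - p))) ∨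
        (uderiv u a < 0 ∧ energy p K f u a < 0)) := by
  have hp1 : 0 < p - 1 := by linarith
  have hq : 0 < (k : ℝ) + 1 - p := by linarith
  by_cases hR : Rend u = ⊤
  · have hgood : ∀ t > 0, GoodAt u t := fun t ht =>
      goodAt_of_lt_Rend ht (hR ▸ ENNReal.ofReal_lt_top)
    have hposAll : ∀ a, ∀ t ∈ Icc 0 a, 0 < u t := fun a t ht => by
      rcases ht.1.eq_or_lt with rfl | h0
      · linarith
      · exact (hgood t h0).1
    rw [hR, endFilter_top] at hl
    rcases (h.limit_le hK hf1 hf hp hpk hu₀ hgood hl).lt_or_eq with hlt | rfl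
    · obtain ⟨M, hM⟩ := eventually_atTop.1
        ((hl.eventually_lt_const hlt).and (hl.eventually_const_lt (half_lt_self hl0)))
      obtain ⟨a, haM, ha, hs⟩ := h.exists_small_slope hgood
        (ε := l / 2 / ((p - 1) / (k + 1 - p))) (by positivity) M
      obtain ⟨h1, h2⟩ := hM a haM.le
      rw [lt_div_iff₀ (by positivity)] at hs
      exact ⟨a, ha, hposAll a, Or.inl ⟨h1, by linarith⟩⟩
    · have hF := Fint_neg hf1 hf hu₀
      have hFl : ∀ᶠ r in atTop, Fint f (u r) < Fint f l / 2 :=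
        ((Fint_hasDerivAt hf hl0).continuousAt.tendsto.comp hl).eventually_lt_const (by linarith)
      obtain ⟨M, hM⟩ := eventually_atTop.1 hFl
      have hK1 := hK.1 1 one_pos
      set e := K 1 * (-Fint f l / 2) with he
      have he0 : 0 < e := mul_pos hK1 (by linarith)
      obtain ⟨a, haM, ha, hs⟩ := h.exists_small_slope hgood
        (ε := e ^ (1 / p)) (by positivity) (max M 1)
      have hda := (hgood a ha).2
      have hv : 0 < -uderiv u a := by linarith
      have h1 := hM a ((le_max_left _ _).trans haM.le)
      have h2 : a ^ p * (-uderiv u a) ^ p < e := by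
        have := Real.rpow_lt_rpow (by positivity) hs (show 0 < p by linarith)
        rwa [← Real.rpow_mul he0.le, one_div_mul_cancel (by linarith), Real.rpow_one,
          Real.mul_rpow ha.le hv.le] at this
      have h3 := hK.monotoneOn (mem_Ioi.2 one_pos) ha
        ((le_max_right M 1).trans haM.le)
      simp only [Real.one_rpow, one_mul] at h3
      have hKa := hK.1 a ha
      have hap : 0 < a ^ p := Real.rpow_pos_of_pos ha _
      have h4 : (-uderiv u a) ^ p / K a < -Fint f l / 2 := by
        rw [div_lt_iff₀ hKa]
        have h5 : e ≤ a ^ p * K a * (-Fint f l / 2) :=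
          mul_le_mul_of_nonneg_right h3 (by linarith)
        have h6 : a ^ p * (-uderiv u a) ^ p < a ^ p * (-Fint f l / 2 * K a) := by linarith
        exact lt_of_mul_lt_mul_left h6 hap.le
      refine ⟨a, ha, hposAll a, Or.inr ⟨hda, ?_⟩⟩
      have h7 : 0 ≤ (-uderiv u a) ^ p / K a := by positivity
      have h8 : (p - 1) / p ≤ 1 := by rw [div_le_one (by linarith)]; linarith
      have h9 := mul_le_mul_of_nonneg_right h8 h7
      unfold energy
      linarith
  · obtain ⟨ρ, hρ, hRρ, hgood, -, hd, hng⟩ := h.finite_end hR0 hR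
    rw [hRρ, endFilter_ofReal hρ.le] at hl
    have hlρ := tendsto_nhds_unique hl ((h.continuousAt hρ).mono_left nhdsWithin_le_nhds)
    have hd0 : uderiv u ρ = 0 := by
      refine hd.antisymm (not_lt.1 fun hlt => hng ⟨hlρ ▸ hl0, hlt⟩)
    refine ⟨ρ, hρ, fun t ht => ?_, Or.inl ⟨h.end_value_lt hK hf1 hρ hgood hd0, ?_⟩⟩
    · rcases ht.1.eq_or_lt with rfl | h0
      · linarith
      · rcases ht.2.eq_or_lt with rfl | h1
        · exact hlρ ▸ hl0
        · exact (hgood t ⟨h0, h1⟩).1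
    · rw [hd0]
      simpa using hlρ ▸ hl0

/-- A crossing solution becomes negative while still decreasing. -/
theorem exists_neg_of_crossing (h : RadialProfile p k K f u) (hR0 : 0 < Rend u)
    (hl : Tendsto u (endFilter (Rend u)) (𝓝 0)) {L : ℝ} (hL : L < 0)
    (hd : Tendsto (uderiv u) (endFilter (Rend u)) (𝓝 L)) :
    ∃ b > 0, u b < 0 ∧ ∀ t ∈ Ioc 0 b, uderiv u t < 0 := by
  by_cases hR : Rend u = ⊤
  · have hgood : ∀ t > 0, GoodAt u t := fun t ht =>
      goodAt_of_lt_Rend ht (hR ▸ ENNReal.ofReal_lt_top)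
    rw [hR, endFilter_top] at hd
    obtain ⟨M, hM⟩ := eventually_atTop.1 (hd.eventually_lt_const (show L < L / 2 by linarith))
    obtain ⟨r, hr, hr0, hs⟩ := h.exists_small_slope hgood (ε := -(L / 2)) (by linarith) (max M 1)
    have h1 := hM r ((le_max_left _ _).trans hr.le)
    have h2 : 1 < r := (le_max_right _ _).trans_lt hr
    nlinarith
  · obtain ⟨ρ, hρ, hRρ, hgood, -, -, -⟩ := h.finite_end hR0 hR
    rw [hRρ, endFilter_ofReal hρ.le] at hl hd
    have hlρ := tendsto_nhds_unique hl ((h.continuousAt hρ).mono_left nhdsWithin_le_nhds)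
    have hdρ := tendsto_nhds_unique hd ((h.continuousAt_deriv hρ).mono_left nhdsWithin_le_nhds)
    obtain ⟨ε, hε, hball⟩ := Metric.eventually_nhds_iff.1
      ((h.continuousAt_deriv hρ).eventually_lt_const (hdρ ▸ hL))
    have hneg : ∀ t ∈ Ioc 0 (ρ + ε / 2), uderiv u t < 0 := fun t ht => by
      rcases lt_or_ge t ρ with hlt | hge
      · exact (hgood t ⟨ht.1, hlt⟩).2
      · refine hball ?_
        rw [Real.dist_eq, abs_of_nonneg (by linarith)]
        linarith [ht.2]
    refine ⟨ρ + ε / 2, by positivity, ?_, hneg⟩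
    have := h.strictAntiOn (fun t ht => hneg t ⟨ht.1, ht.2.le⟩) (a := ρ) (b := ρ + ε / 2)
      ⟨hρ.le, by linarith⟩ ⟨by linarith, le_rfl⟩ (by linarith)
    linarith

theorem crossing_of_exists_neg (h : RadialProfile p k K f u) (hu0 : 0 < u 0) {l b : ℝ}
    (hl : Tendsto u (endFilter (Rend u)) (𝓝 l)) (hb : 0 < b) (hub : u b < 0)
    (hneg : ∀ t ∈ Ioc 0 b, uderiv u t < 0) :
    l = 0 ∧ ∃ L < 0, Tendsto (uderiv u) (endFilter (Rend u)) (𝓝 L) := by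
  have hanti := h.strictAntiOn (b := b) fun t ht => hneg t ⟨ht.1, ht.2.le⟩
  obtain ⟨ρ, hρ, hρ0⟩ := intermediate_value_Icc' hb.le (h.cont.mono fun x hx => hx.1)
    (show (0 : ℝ) ∈ Icc (u b) (u 0) from ⟨hub.le, hu0.le⟩)
  have hρpos : 0 < ρ := hρ.1.lt_of_ne fun h0 => by rw [← h0] at hρ0; linarith
  have hRρ : Rend u = ENNReal.ofReal ρ := by
    refine Rend_eq hρpos (fun t ht => ⟨?_, hneg t ⟨ht.1, ht.2.le.trans hρ.2⟩⟩) fun hg => ?_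
    · exact hρ0 ▸ hanti ⟨ht.1.le, ht.2.le.trans hρ.2⟩ hρ ht.2
    · exact hg.1.ne' hρ0
  rw [hRρ, endFilter_ofReal hρpos.le] at hl ⊢
  refine ⟨?_, uderiv u ρ, hneg ρ ⟨hρpos, hρ.2⟩,
    (h.continuousAt_deriv hρpos).mono_left nhdsWithin_le_nhds⟩
  rw [← hρ0]
  exact tendsto_nhds_unique hl ((h.continuousAt hρpos).mono_left nhdsWithin_le_nhds)

end RadialProfile

section Family

variable {g : ℝ → ℝ → ℝ} {u₀ α : ℝ}

theorem continuousAt_param (hg : ContinuousOn (fun q : ℝ × ℝ => g q.1 q.2) (Ioi u₀ ×ˢ Ici 0))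
    (hα : u₀ < α) {t : ℝ} (ht : 0 ≤ t) : ContinuousAt (fun β => g β t) α := by
  have : ContinuousOn (fun β => g β t) (Ioi u₀) :=
    hg.comp (f := fun β : ℝ => (β, t)) (by fun_prop) fun β hβ => ⟨hβ, ht⟩
  exact this.continuousAt (Ioi_mem_nhds hα)

theorem eventually_forall_Icc_lt
    (hg : ContinuousOn (fun q : ℝ × ℝ => g q.1 q.2) (Ioi u₀ ×ˢ Ici 0)) (hα : u₀ < α)
    {a b c : ℝ} (ha : 0 ≤ a) (h : ∀ t ∈ Icc a b, c < g α t) :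
    ∀ᶠ β in 𝓝 α, ∀ t ∈ Icc a b, c < g β t := by
  have hg' : ContinuousOn (fun q : ℝ × ℝ => g q.1 (max q.2 0)) (Ioi u₀ ×ˢ univ) :=
    hg.comp (f := fun q : ℝ × ℝ => (q.1, max q.2 0)) (by fun_prop)
      fun q hq => ⟨hq.1, le_max_right q.2 0⟩
  have := (isCompact_Icc (a := a) (b := b)).eventually_forall_of_forall_eventually
    (x₀ := α) (P := fun β t => c < g β (max t 0)) fun t ht => by
      have hc : ContinuousAt (fun q : ℝ × ℝ => g q.1 (max q.2 0)) (α, t) :=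
        hg'.continuousAt ((isOpen_Ioi.prod isOpen_univ).mem_nhds ⟨hα, mem_univ _⟩)
      refine hc.eventually_const_lt ?_
      simpa [max_eq_left (ha.trans ht.1)] using h t ht
  filter_upwards [this] with β hβ t ht
  simpa [max_eq_left (ha.trans ht.1)] using hβ t ht

end Family

/-- Lemma 2.1: the sets `N` and `P` are open. -/
theorem Ncross_and_Pset_open
    (p : ℝ) (n : ℕ) (hp : 1 < p) (hn : p < n)
    (K f : ℝ → ℝ) (u₀ : ℝ) (hu₀ : 0 < u₀)
    (hK : CondK1 p K) (hf1 : CondF1 f u₀) (hf2 : CondF2 f u₀)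
    (u : ℝ → ℝ → ℝ) (hfam : IsFamily p n K f u₀ u)
    (uR : ℝ → ℝ)
    (huR : ∀ α : ℝ, u₀ < α → Tendsto (u α) (endFilter (Rend (u α))) (𝓝 (uR α))) :
    IsOpen (Ncross u uR u₀) ∧ IsOpen (Pset uR u₀) := by
  have hpk : p < ((n - 1 : ℕ) : ℝ) + 1 := by
    have : 1 ≤ n := by
      have : (0 : ℝ) < n := by linarith
      exact_mod_cast this
    rw [Nat.cast_sub this]
    simpa using hn
  obtain ⟨hsol, hcu, hcd⟩ := hfam
  have hprof : ∀ α, u₀ < α → RadialProfile p (n - 1) K f (u α) := fun α hα =>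
    (hsol α hα).1.radialProfile (hsol α hα).2.2
  have hu0 : ∀ α, u₀ < α → u₀ < u α 0 := fun α hα => (hsol α hα).2.1.symm ▸ hα
  have hR0 : ∀ α, u₀ < α → 0 < Rend (u α) := fun α hα =>
    (hprof α hα).Rend_pos hK.1 hf1.2.1 hu₀ (hu0 α hα)
  refine ⟨isOpen_iff_mem_nhds.2 ?_, isOpen_iff_mem_nhds.2 ?_⟩
  · rintro α ⟨hα, hα0, L, hL, hLt⟩
    obtain ⟨b, hb, hub, hneg⟩ := (hprof α hα).exists_neg_of_crossing (hR0 α hα)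
      (hα0 ▸ huR α hα) hL hLt
    obtain ⟨δ, hδ, hgt⟩ := (hprof α hα).exists_gt_near_zero (hu0 α hα)
    have hcd' : ContinuousOn (fun q : ℝ × ℝ => -uderiv (u q.1) q.2) (Ioi u₀ ×ˢ Ici 0) := hcd.neg
    filter_upwards [Ioi_mem_nhds hα, (continuousAt_param hcu hα hb.le).eventually_lt_const hub,
      eventually_forall_Icc_lt hcu hα le_rfl hgt,
      eventually_forall_Icc_lt (g := fun β t => -uderiv (u β) t) hcd' hα
        (a := δ) (b := b) (c := 0) hδ.le fun t ht =>
        neg_pos.2 (hneg t ⟨hδ.trans_le ht.1, ht.2⟩)] with β hβ h1 h2 h3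
    refine ⟨hβ, (hprof β hβ).crossing_of_exists_neg (hu₀.trans (hu0 β hβ)) (huR β hβ) hb h1 ?_⟩
    intro t ht
    rcases le_or_gt t δ with hle | hlt
    · exact (hprof β hβ).uderiv_neg hK.1 hf1.2.1 (fun s hs => h2 s ⟨hs.1.le, hs.2.le⟩) t
        ⟨ht.1, hle⟩
    · exact neg_pos.1 (h3 t ⟨hlt.le, ht.2⟩)
  · rintro α ⟨hα, hα0⟩
    obtain ⟨a, ha, hpos, hcase⟩ := (hprof α hα).exists_drop_or_energy hK hf1 hf2.1 hp hpk hu₀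
      (hR0 α hα) (hu0 α hα) (huR α hα) hα0
    have hca := continuousAt_param hcu hα ha.le
    have hda : ContinuousAt (fun β => uderiv (u β) a) α :=
      continuousAt_param (g := fun β t => uderiv (u β) t) hcd hα ha.le
    have hevpos := eventually_forall_Icc_lt hcu hα le_rfl hpos
    rcases hcase with ⟨h1, h2⟩ | ⟨h1, h2⟩
    · have hc : ContinuousAt (fun β => u β a - a * -uderiv (u β) a *
          ((p - 1) / (((n - 1 : ℕ) : ℝ) + 1 - p))) α :=
        hca.sub ((continuousAt_const.mul hda.neg).mul continuousAt_const)
      filter_upwards [Ioi_mem_nhds hα, hevpos, hca.eventually_lt_const h1,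
        hc.eventually_const_lt h2] with β hβ e1 e2 e3
      exact ⟨hβ, (hprof β hβ).limit_pos_of_drop hK hf1 hp hpk (hR0 β hβ) (huR β hβ) ha e1 e2 e3⟩
    · have hc : ContinuousAt (fun β => energy p K f (u β) a) α := by
        refine ContinuousAt.add (continuousAt_const.mul (ContinuousAt.div_const ?_ _)) ?_
        · exact hda.neg.rpow_const (Or.inr (by linarith))
        · exact ContinuousAt.comp (g := Fint f) (f := fun β => u β a)
            (Fint_hasDerivAt hf2.1 (hpos a ⟨ha.le, le_rfl⟩)).continuousAt hca
      filter_upwards [Ioi_mem_nhds hα, hevpos, hc.eventually_lt_const h2] with β hβ e1 e2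
      exact ⟨hβ, (hprof β hβ).limit_pos_of_energy hK hf2.1 hp hpk (hR0 β hβ) (huR β hβ) ha e1 e2⟩
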